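/- For every family ℰ of n pairwise edge-disjoint nonempty subgraphs of K_{n+1}, ℰ has no rainbow cycle if and only if ℰ is a linkleaf. -/

import Mathlib

/-- The set of vertices incident to an edge set. -/
def edgeVerts {V : Type*} (S : Set (Sym2 V)) : Set V := {v | ∃ e ∈ S, v ∈ e}

/-- The union of a multiset family of edge sets. -/
def famUnion {α : Type*} (F : Multiset (Finset α)) : Set α := {e | ∃ S ∈ F, e ∈ S}

/-- `C` is the edge set of a cycle (of length ≥ 3) in the complete graph on `V`. -/
def IsCycleEdgeSet {V : Type*} [DecidableEq V] (C : Finset (Sym2 V)) : Prop :=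
  ∃ (v : V) (w : (⊤ : SimpleGraph V).Walk v v), w.IsCycle ∧ w.edges.toFinset = C

/-- `C` is the edge set of an odd cycle. -/
def IsOddCycleEdgeSet {V : Type*} [DecidableEq V] (C : Finset (Sym2 V)) : Prop :=
  IsCycleEdgeSet C ∧ Odd C.card

/-- `R` is a rainbow set for the indexed family `F`. -/
def IsRainbow {α ι : Type*} (F : ι → Finset α) (R : Finset α) : Prop :=
  ∃ σ : α → ι, Set.InjOn σ ↑R ∧ ∀ e ∈ R, e ∈ F (σ e)

/-- `R` is a rainbow set for the multiset family `F`: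
each element of `R` is assigned a member of `F` containing it, members being
used with multiplicity at most their multiplicity in `F`. -/
def IsRainbowM {α : Type*} (F : Multiset (Finset α)) (R : Finset α) : Prop :=
  ∃ f : α → Finset α, Multiset.map f R.val ≤ F ∧ ∀ e ∈ R, e ∈ f e

/-- A family of cycles is a pruned cactus. -/
inductive IsPrunedCactus {V : Type*} [DecidableEq V] : Multiset (Finset (Sym2 V)) → Prop
  | base (O : Multiset (Finset (Sym2 V))) (C : Finset (Sym2 V)) :
      IsCycleEdgeSet C → C.card = Multiset.card O + 1 →
      (∀ D ∈ O, D = C) → IsPrunedCactus O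
  | glue (O₁ O₂ : Multiset (Finset (Sym2 V))) :
      IsPrunedCactus O₁ → IsPrunedCactus O₂ →
      (∃ v, edgeVerts (famUnion O₁) ∩ edgeVerts (famUnion O₂) = {v}) →
      IsPrunedCactus (O₁ + O₂)

/-- `IsLinkleafOn W ℰ` : the family `ℰ` is a linkleaf with underlying vertex set `W`. -/
inductive IsLinkleafOn {V : Type*} : Set V → Multiset (Finset (Sym2 V)) → Prop
  | single (v : V) : IsLinkleafOn {v} 0
  | glue (W₁ W₂ : Set V) (E₁ E₂ : Multiset (Finset (Sym2 V))) (B : Finset (Sym2 V)) :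
      IsLinkleafOn W₁ E₁ → IsLinkleafOn W₂ E₂ → Disjoint W₁ W₂ → B.Nonempty →
      (∀ e ∈ B, ∃ u v, e = s(u, v) ∧ u ∈ W₁ ∧ v ∈ W₂) →
      IsLinkleafOn (W₁ ∪ W₂) (E₁ + B ::ₘ E₂)

theorem key_linear {ι M : Type*} [Fintype ι] [DecidableEq ι] [Nonempty ι] [AddCommGroup M]
    [Module (ZMod 2) M] [Module.Finite (ZMod 2) M] (hr : Fintype.card ι = Module.finrank (ZMod 2) M)
    (S : ι → Set M) (hne : ∀ i, (S i).Nonempty)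
    (hind : ∀ x : ι → M, (∀ i, x i ∈ S i) → LinearIndependent (ZMod 2) x) :
    ∃ i, ∃ l : M →ₗ[ZMod 2] ZMod 2, (∀ y ∈ S i, l y = 1) ∧ ∀ j, j ≠ i → ∀ y ∈ S j, l y = 0 := by
  classical
  choose t ht using hne
  have z2 : ∀ a : ZMod 2, a ≠ 0 → a = 1 := by decide
  let b := basisOfLinearIndependentOfCardEqFinrank (hind t ht) hr
  have hb : ∀ i, b i = t i := fun i => by simp [b]
  have hdiag : ∀ i, ∀ y ∈ S i, b.coord i y = 1 := by
    intro i y hy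
    apply z2
    intro h0
    have hli := hind (Function.update t i y) (by
      intro j
      by_cases h : j = i
      · subst h; simpa using hy
      · simpa [h] using ht j)
    rw [linearIndependent_iff'] at hli
    have := hli Finset.univ (fun j => if j = i then 1 else b.coord j y) (by
      have h1 := b.sum_repr y
      rw [← Finset.add_sum_erase _ _ (Finset.mem_univ i)] at h1 ⊢
      have h0' : b.repr y i = 0 := h0
      rw [h0', zero_smul, zero_add] at h1
      have h2 : ∑ j ∈ Finset.univ.erase i, (if j = i then (1 : ZMod 2) else b.coord j y) •
          Function.update t i y j = y := by
        conv_rhs => rw [← h1]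
        apply Finset.sum_congr rfl
        intro j hj
        have hj' := Finset.ne_of_mem_erase hj
        simp [hj', hb]
      rw [h2]
      simp only [if_true, Function.update_self, one_smul]
      rw [← two_smul (ZMod 2) y]
      have : (2 : ZMod 2) = 0 := by decide
      rw [this, zero_smul]) i (Finset.mem_univ i)
    simp at this
  by_contra hcon
  push Not at hcon
  have hcon' : ∀ i, ∃ j, j ≠ i ∧ ∃ y ∈ S j, b.coord i y = 1 := by
    intro i
    obtain ⟨j, hj, y, hy, h⟩ := hcon i (b.coord i) (hdiag i)
    exact ⟨j, hj, y, hy, z2 _ h⟩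
  let P : Finset ι → Prop := fun I => I.Nonempty ∧
    ∀ i ∈ I, ∃ j ∈ I, j ≠ i ∧ ∃ y ∈ S j, b.coord i y = 1
  obtain ⟨I, ⟨hIne, hI⟩, hmin⟩ : ∃ I, P I ∧ ∀ J, P J → I.card ≤ J.card := by
    have hP : ∃ k, ∃ I, P I ∧ I.card = k :=
      ⟨_, Finset.univ, ⟨Finset.univ_nonempty, fun i _ => by
        obtain ⟨j, hj⟩ := hcon' i
        exact ⟨j, Finset.mem_univ _, hj⟩⟩, rfl⟩
    obtain ⟨I, h1, h2⟩ := Nat.find_spec hP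
    exact ⟨I, h1, fun J hJ => h2 ▸ Nat.find_min' hP ⟨J, hJ, rfl⟩⟩
  have hsel : ∀ p : ι → ι, (∀ i ∈ I, p i ∈ I ∧ p i ≠ i ∧ ∃ y ∈ S (p i), b.coord i y = 1) →
      Set.InjOn p I := by
    intro p hp
    have h1 : P (I.image p) := by
      refine ⟨hIne.image p, fun i hi => ?_⟩
      obtain ⟨k, hk, rfl⟩ := Finset.mem_image.1 hi
      exact ⟨p (p k), Finset.mem_image_of_mem _ (hp k hk).1, (hp _ (hp k hk).1).2⟩
    exact Finset.card_image_iff.1 (le_antisymm Finset.card_image_le (hmin _ h1))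
  choose! p hpI hpne y hyS hy1 using hI
  have hpinj := hsel p (fun i hi => ⟨hpI i hi, hpne i hi, y i, hyS i hi, hy1 i hi⟩)
  have hpimg : I.image p = I := by
    apply Finset.eq_of_subset_of_card_le
    · intro j hj
      obtain ⟨k, hk, rfl⟩ := Finset.mem_image.1 hj
      exact hpI k hk
    · rw [Finset.card_image_iff.2 hpinj]
  have hchord : ∀ i ∈ I, ∀ j ∈ I, j ≠ i → j ≠ p i → ∀ z ∈ S j, b.coord i z = 0 := by
    intro i hi j hj hji hjp z hz
    by_contra h
    have h1 := hsel (Function.update p i j) (by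
      intro k hk
      by_cases hki : k = i
      · subst hki
        simpa using ⟨hj, hji, z, hz, z2 _ h⟩
      · simpa [hki] using ⟨hpI k hk, hpne k hk, y k, hyS k hk, hy1 k hk⟩)
    rw [← hpimg] at hj
    obtain ⟨k, hk, hkj⟩ := Finset.mem_image.1 hj
    have hki : k ≠ i := by rintro rfl; exact hjp hkj.symm
    exact hki (h1 hk hi (by simp [hki, hkj]))
  have hinv : ∀ j ∈ I, ∃ i ∈ I, p i = j := by
    intro j hj
    rw [← hpimg] at hj
    simpa using hj
  choose! q hqI hq using hinv
  let x : ι → M := fun j => if j ∈ I then y (q j) else t j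
  have hx : ∀ j, x j ∈ S j := by
    intro j
    by_cases hj : j ∈ I
    · have := hyS (q j) (hqI j hj)
      rw [hq j hj] at this
      simpa [x, hj] using this
    · simpa [x, hj] using ht j
  have hqp : ∀ i ∈ I, q (p i) = i := fun i hi =>
    hpinj (hqI _ (hpI i hi)) hi (hq _ (hpI i hi))
  set s := ∑ j ∈ I, x j with hs
  have hcoord : ∀ i ∈ I, b.coord i s = 0 := by
    intro i hi
    rw [hs, map_sum, ← Finset.add_sum_erase _ _ hi, ← Finset.add_sum_erase _ _
      (Finset.mem_erase.2 ⟨hpne i hi, hpI i hi⟩), hdiag i _ (hx i)]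
    have h1 : b.coord i (x (p i)) = 1 := by
      have : x (p i) = y i := by simp only [x, hpI i hi, if_true, hqp i hi]
      rw [this, hy1 i hi]
    rw [h1, Finset.sum_eq_zero]
    · decide
    · intro j hj
      simp only [Finset.mem_erase] at hj
      exact hchord i hi j hj.2.2 hj.2.1 hj.1 _ (hx j)
  have hli := hind x hx
  rw [linearIndependent_iff'] at hli
  obtain ⟨i, hi⟩ := hIne
  have := hli Finset.univ (fun j => if j ∈ I then 1 else b.coord j s) (by
    have h1 : ∑ j, (if j ∈ I then (1 : ZMod 2) else b.coord j s) • x j = s + s := by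
      have h2 : ∑ j, (if j ∈ I then x j else 0) = s := by
        rw [Finset.sum_ite_mem, Finset.univ_inter]
      nth_rewrite 2 [← b.sum_repr s]
      rw [← h2, ← Finset.sum_add_distrib, h2]
      apply Finset.sum_congr rfl
      intro j _
      by_cases hj : j ∈ I
      · have : b.repr s j = 0 := hcoord j hj
        simp [hj, this]
      · simp [hj, x, hb]
    rw [h1, ← two_smul (ZMod 2) s]
    have : (2 : ZMod 2) = 0 := by decide
    rw [this, zero_smul]) i (Finset.mem_univ i)
  simp [hi] at this

/-- Indicator of a vertex, restricted to the coordinates in `U`. -/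
def vvec {V : Type*} [DecidableEq V] (U : Finset V) (v : V) : U → ZMod 2 :=
  fun k => if k.1 = v then 1 else 0

/-- Incidence vector of an edge, restricted to the coordinates in `U`. -/
def evec {V : Type*} [DecidableEq V] (U : Finset V) (e : Sym2 V) : U → ZMod 2 :=
  Sym2.lift ⟨fun u v => vvec U u + vvec U v, fun _ _ => add_comm _ _⟩ e

theorem evec_mk {V : Type*} [DecidableEq V] (U : Finset V) (u v : V) :
    evec U s(u, v) = vvec U u + vvec U v := rfl

theorem indep_of_no_cycle {V ι : Type*} [DecidableEq V] [Fintype ι]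
    (W : Finset V) (w0 : V) (x : ι → Sym2 V) (hinj : Function.Injective x)
    (hnd : ∀ i, ¬ (x i).IsDiag) (hW : ∀ i, ∀ v ∈ x i, v ∈ W)
    (hcyc : ∀ R : Finset (Sym2 V), (∀ e ∈ R, ∃ i, x i = e) → ¬ IsCycleEdgeSet R) :
    LinearIndependent (ZMod 2) (fun i => evec (W.erase w0) (x i)) := by
  classical
  let G := SimpleGraph.fromEdgeSet (Set.range x)
  have hac : G.IsAcyclic := by
    intro v w hw
    refine hcyc w.edges.toFinset ?_ ⟨v, w.mapLe le_top, hw.mapLe le_top, by simp⟩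
    intro e he
    have := w.edges_subset_edgeSet (List.mem_toFinset.1 he)
    simp only [G, SimpleGraph.edgeSet_fromEdgeSet] at this
    exact this.1
  have hsep : ∀ i, ∃ l : (W.erase w0 → ZMod 2) →ₗ[ZMod 2] ZMod 2,
      l (evec _ (x i)) = 1 ∧ ∀ j, j ≠ i → l (evec _ (x j)) = 0 := by
    intro i
    obtain ⟨u, v, huv⟩ : ∃ u v, x i = s(u, v) := by
      induction h : x i with | _ u v => exact ⟨u, v, rfl⟩
    have hne : u ≠ v := by
      have := hnd i
      rw [huv] at this
      simpa using this
    have hmem : s(u, v) ∈ G.edgeSet := by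
      simp only [G, SimpleGraph.edgeSet_fromEdgeSet]
      exact ⟨⟨i, huv⟩, by simpa using hne⟩
    have hbr := SimpleGraph.isBridge_iff.1 (SimpleGraph.isAcyclic_iff_forall_isBridge.1 hac hmem)
    set H := G.deleteEdges {s(u, v)} with hH
    obtain ⟨a, b, hab, ha0, hbr'⟩ : ∃ a b, x i = s(a, b) ∧ ¬ H.Reachable a w0 ∧
        ¬ H.Reachable a b := by
      by_cases h : H.Reachable u w0
      · refine ⟨v, u, by rw [huv, Sym2.eq_swap], fun h' => hbr (h.trans h'.symm),
          fun h' => hbr h'.symm⟩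
      · exact ⟨u, v, huv, h, hbr⟩
    let l : (W.erase w0 → ZMod 2) →ₗ[ZMod 2] ZMod 2 :=
      ∑ k : W.erase w0, (if H.Reachable a k.1 then (1 : ZMod 2) else 0) • LinearMap.proj k
    have hl : ∀ c ∈ W, l (vvec _ c) = if H.Reachable a c then 1 else 0 := by
      intro c hc
      simp only [l, LinearMap.sum_apply, LinearMap.smul_apply, LinearMap.proj_apply, vvec]
      by_cases hc0 : c = w0
      · subst hc0
        rw [if_neg ha0]
        apply Finset.sum_eq_zero
        intro k _
        have : k.1 ≠ c := (Finset.mem_erase.1 k.2).1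
        simp [this]
      · rw [Finset.sum_eq_single ⟨c, Finset.mem_erase.2 ⟨hc0, hc⟩⟩]
        · simp
        · intro k _ hk
          have : k.1 ≠ c := fun h => hk (Subtype.ext h)
          simp [this]
        · simp
    refine ⟨l, ?_, ?_⟩
    · rw [hab, evec_mk, map_add, hl a (hW i a (by simp [hab])), hl b (hW i b (by simp [hab]))]
      simp [hbr']
    · intro j hj
      obtain ⟨c, d, hcd⟩ : ∃ c d, x j = s(c, d) := by
        induction h : x j with | _ u v => exact ⟨u, v, rfl⟩
      have hadj : H.Adj c d := by
        rw [hH, SimpleGraph.deleteEdges_adj]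
        refine ⟨?_, ?_⟩
        · simp only [G, SimpleGraph.fromEdgeSet_adj]
          refine ⟨⟨j, hcd⟩, ?_⟩
          have := hnd j
          rw [hcd] at this
          simpa using this
        · intro h
          rw [Set.mem_singleton_iff, ← hcd, ← huv] at h
          exact hj (hinj h)
      have hiff : H.Reachable a c ↔ H.Reachable a d :=
        ⟨fun h => h.trans hadj.reachable, fun h => h.trans hadj.symm.reachable⟩
      rw [hcd, evec_mk, map_add, hl c (hW j c (by simp [hcd])), hl d (hW j d (by simp [hcd]))]
      by_cases h : H.Reachable a d
      · simp only [hiff, h, if_true]; decide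
      · simp [hiff, h]
  rw [linearIndependent_iff']
  intro s g hg i hi
  obtain ⟨l, h1, h2⟩ := hsep i
  have := congrArg l hg
  rw [map_sum, Finset.sum_eq_single i] at this
  · simpa [h1] using this
  · intro j _ hj
    rw [map_smul, h2 j hj, smul_zero]
  · exact fun h => absurd hi h

/-- Subsets of transversals of a disjoint family are rainbow. -/
theorem rainbow_of_transversal {α : Type*} (C : Finset (Finset α)) (R : Finset α)
    (D : Finset (Finset α)) (hD : D ⊆ C) (x : D → α) (hinj : Function.Injective x)
    (hx : ∀ S, x S ∈ S.1) (hR : ∀ e ∈ R, ∃ i, x i = e) : IsRainbowM C.val R := by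
  classical
  by_cases hDn : Nonempty D
  swap
  · have : R = ∅ := by
      apply Finset.eq_empty_of_forall_notMem
      intro e he
      exact hDn ⟨(hR e he).choose⟩
    subst this
    exact ⟨fun _ => ∅, by simp, by simp⟩
  have hy' : ∀ e, ∃ i : D, e ∈ R → x i = e := by
    intro e
    by_cases he : e ∈ R
    · obtain ⟨i, hi⟩ := hR e he
      exact ⟨i, fun _ => hi⟩
    · exact ⟨hDn.some, fun h => absurd h he⟩
  choose z hz using hy'
  refine ⟨fun e => (z e).1, ?_, ?_⟩
  · rw [Multiset.le_iff_subset]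
    · intro S hS
      obtain ⟨e, _, rfl⟩ := Multiset.mem_map.1 hS
      exact hD (z e).2
    · refine Multiset.Nodup.map_on ?_ R.nodup
      intro a ha b hb hab
      rw [← hz a ha, ← hz b hb, Subtype.ext hab]
  · intro e he
    have := hx (z e)
    rwa [hz e he] at this

theorem linkleaf_of_no_rainbow {V : Type*} [DecidableEq V] :
    ∀ (n : ℕ) (W : Finset V) (C : Finset (Finset (Sym2 V))), W.card = n + 1 → C.card = n →
    (∀ S ∈ C, S.Nonempty) → (∀ S ∈ C, ∀ e ∈ S, ¬ e.IsDiag) → (∀ S ∈ C, ∀ e ∈ S, ∀ v ∈ e, v ∈ W) →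
    (∀ S ∈ C, ∀ T ∈ C, S ≠ T → Disjoint S T) →
    (∀ R, IsRainbowM C.val R → ¬ IsCycleEdgeSet R) → IsLinkleafOn (W : Set V) C.val := by
  classical
  intro n
  induction n using Nat.strong_induction_on with
  | _ n ih =>
  intro W C hW hC hne hnd hin hdis hcyc
  have hind : ∀ (U : Finset V) (w : V) (D : Finset (Finset (Sym2 V))), D ⊆ C →
      ∀ x : D → Sym2 V, (∀ S, x S ∈ S.1) → (∀ S, ∀ v ∈ x S, v ∈ U) →
      LinearIndependent (ZMod 2) (fun i => evec (U.erase w) (x i)) := by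
    intro U w D hD x hx hxU
    have hinj : Function.Injective x := by
      intro S T hST
      by_contra h
      have := hdis S.1 (hD S.2) T.1 (hD T.2) (fun h' => h (Subtype.ext h'))
      exact Finset.disjoint_left.1 this (hx S) (hST ▸ hx T)
    exact indep_of_no_cycle U w x hinj (fun S => hnd _ (hD S.2) _ (hx S)) hxU
      (fun R hR => hcyc R (rainbow_of_transversal C R D hD x hinj hx hR))
  have hbound : ∀ (U : Finset V) (w : V), w ∈ U →
      (C.filter (fun S => ∃ e ∈ S, ∀ v ∈ e, v ∈ U)).card + 1 ≤ U.card := by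
    intro U w hw
    have h : ∀ S : C.filter (fun S => ∃ e ∈ S, ∀ v ∈ e, v ∈ U), ∃ e ∈ S.1, ∀ v ∈ e, v ∈ U :=
      fun S => (Finset.mem_filter.1 S.2).2
    choose x hx hxU using h
    have := (hind U w _ (Finset.filter_subset _ _) x hx hxU).fintype_card_le_finrank
    rw [Module.finrank_fintype_fun_eq_card, Fintype.card_coe, Fintype.card_coe,
      Finset.card_erase_of_mem hw] at this
    have : 0 < U.card := Finset.card_pos.2 ⟨w, hw⟩
    omega
  rcases Nat.eq_zero_or_pos n with h0 | hpos
  · subst h0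
    obtain ⟨v, rfl⟩ := Finset.card_eq_one.1 hW
    rw [Finset.card_eq_zero.1 hC]
    simpa using IsLinkleafOn.single v
  obtain ⟨w0, hw0⟩ : W.Nonempty := Finset.card_pos.1 (by omega)
  have : Nonempty C := by
    obtain ⟨S, hS⟩ := Finset.card_pos.1 (hC ▸ hpos)
    exact ⟨⟨S, hS⟩⟩
  obtain ⟨⟨B, hB⟩, l, hl1, hl0⟩ := key_linear (ι := C) (M := W.erase w0 → ZMod 2)
    (by rw [Module.finrank_fintype_fun_eq_card, Fintype.card_coe, Fintype.card_coe,
          Finset.card_erase_of_mem hw0]; omega)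
    (fun S => evec (W.erase w0) '' (S.1 : Set (Sym2 V)))
    (fun S => Set.Nonempty.image _ (hne S.1 S.2))
    (by
      intro y hy
      choose x hx hxy using hy
      have := hind W w0 C (Finset.Subset.refl _) x hx (fun S => hin _ S.2 _ (hx S))
      simpa only [hxy] using this)
  have hB1 : ∀ e ∈ B, l (evec _ e) = 1 := fun e he => hl1 _ ⟨e, he, rfl⟩
  have hB0 : ∀ S ∈ C, S ≠ B → ∀ e ∈ S, l (evec _ e) = 0 := fun S hS hSB e he =>
    hl0 ⟨S, hS⟩ (fun h => hSB (congrArg Subtype.val h)) _ ⟨e, he, rfl⟩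
  let g : V → ZMod 2 := fun v => l (vvec _ v)
  have hg : ∀ u v, l (evec _ s(u, v)) = g u + g v := fun u v => by rw [evec_mk, map_add]
  have z2 : ∀ a : ZMod 2, a = 0 ∨ a = 1 := by decide
  have z00 : ∀ a b : ZMod 2, a + b = 0 → a = b := by decide
  have z11 : ∀ a b : ZMod 2, a + b = 1 → (a = 0 ∧ b = 1) ∨ (a = 1 ∧ b = 0) := by decide
  let W1 := W.filter (fun v => g v = 0)
  let W2 := W.filter (fun v => g v = 1)
  have hWd : Disjoint W1 W2 := by
    rw [Finset.disjoint_left]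
    intro v h1 h2
    have h1 := (Finset.mem_filter.1 h1).2
    rw [(Finset.mem_filter.1 h2).2] at h1
    exact absurd h1 (by decide)
  have hWu : W1 ∪ W2 = W := by
    ext v
    simp only [W1, W2, Finset.mem_union, Finset.mem_filter, ← and_or_left]
    exact ⟨fun h => h.1, fun h => ⟨h, z2 _⟩⟩
  have hcross : ∀ e ∈ B, ∃ u v, e = s(u, v) ∧ u ∈ W1 ∧ v ∈ W2 := by
    intro e he
    have h1 := hB1 e he
    have h2 := hin B hB e he
    induction e with | _ u v =>
    rw [hg] at h1
    have hu := h2 u (by simp)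
    have hv := h2 v (by simp)
    rcases z11 _ _ h1 with ⟨h, h'⟩ | ⟨h, h'⟩
    · exact ⟨u, v, rfl, by simp [W1, hu, h], by simp [W2, hv, h']⟩
    · exact ⟨v, u, Sym2.eq_swap, by simp [W1, hv, h'], by simp [W2, hu, h]⟩
  have hside : ∀ S ∈ C, S ≠ B → ∀ e ∈ S, (∀ v ∈ e, v ∈ W1) ∨ (∀ v ∈ e, v ∈ W2) := by
    intro S hS hSB e he
    have h1 := hB0 S hS hSB e he
    have h2 := hin S hS e he
    induction e with | _ u v =>
    rw [hg] at h1
    have hu := h2 u (by simp)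
    have hv := h2 v (by simp)
    have h3 := z00 _ _ h1
    rcases z2 (g u) with h | h
    · left
      simp [W1, hu, hv, h, ← h3]
    · right
      simp [W2, hu, hv, h, ← h3]
  obtain ⟨e0, he0⟩ := hne B hB
  obtain ⟨u0, v0, -, hu0, hv0⟩ := hcross e0 he0
  set C1 := C.filter (fun S => ∃ e ∈ S, ∀ v ∈ e, v ∈ W1) with hC1
  set C2 := C.filter (fun S => ∃ e ∈ S, ∀ v ∈ e, v ∈ W2) with hC2
  have hc1 : C1.card + 1 ≤ W1.card := hbound W1 u0 hu0
  have hc2 : C2.card + 1 ≤ W2.card := hbound W2 v0 hv0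
  have hcu : W1.card + W2.card = n + 1 := by
    rw [← Finset.card_union_of_disjoint hWd, hWu, hW]
  have hBn1 : B ∉ C1 := by
    intro h
    obtain ⟨e, he, hv⟩ := (Finset.mem_filter.1 h).2
    obtain ⟨u, v, rfl, _, h2⟩ := hcross e he
    exact Finset.disjoint_left.1 hWd (hv v (by simp)) h2
  have hBn2 : B ∉ C2 := by
    intro h
    obtain ⟨e, he, hv⟩ := (Finset.mem_filter.1 h).2
    obtain ⟨u, v, rfl, h1, _⟩ := hcross e he
    exact Finset.disjoint_left.1 hWd h1 (hv u (by simp))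
  have hunion : C1 ∪ C2 = C.erase B := by
    ext S
    rw [Finset.mem_union, Finset.mem_erase]
    constructor
    · rintro (h | h)
      · exact ⟨fun h' => hBn1 (h' ▸ h), (Finset.mem_filter.1 h).1⟩
      · exact ⟨fun h' => hBn2 (h' ▸ h), (Finset.mem_filter.1 h).1⟩
    · rintro ⟨hSB, hS⟩
      obtain ⟨e, he⟩ := hne S hS
      rcases hside S hS hSB e he with h | h
      · exact Or.inl (Finset.mem_filter.2 ⟨hS, e, he, h⟩)
      · exact Or.inr (Finset.mem_filter.2 ⟨hS, e, he, h⟩)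
  have hcardu := Finset.card_union_add_card_inter C1 C2
  rw [hunion, Finset.card_erase_of_mem hB, hC] at hcardu
  have hCd : Disjoint C1 C2 := by
    rw [Finset.disjoint_iff_inter_eq_empty, ← Finset.card_eq_zero]
    omega
  have hin1 : ∀ S ∈ C1, ∀ e ∈ S, ∀ v ∈ e, v ∈ W1 := by
    intro S hS e he
    have hSC := (Finset.mem_filter.1 hS).1
    rcases hside S hSC (fun h' => hBn1 (h' ▸ hS)) e he with h | h
    · exact h
    · exact absurd (Finset.mem_filter.2 ⟨hSC, e, he, h⟩) (Finset.disjoint_left.1 hCd hS)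
  have hin2 : ∀ S ∈ C2, ∀ e ∈ S, ∀ v ∈ e, v ∈ W2 := by
    intro S hS e he
    have hSC := (Finset.mem_filter.1 hS).1
    rcases hside S hSC (fun h' => hBn2 (h' ▸ hS)) e he with h | h
    · exact absurd (Finset.mem_filter.2 ⟨hSC, e, he, h⟩) (Finset.disjoint_right.1 hCd hS)
    · exact h
  have hrec : ∀ (U : Finset V) (D : Finset (Finset (Sym2 V))), D ⊆ C → D.card < n →
      U.card = D.card + 1 → (∀ S ∈ D, ∀ e ∈ S, ∀ v ∈ e, v ∈ U) → IsLinkleafOn (U : Set V) D.val := by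
    intro U D hD hn hU hDU
    refine ih D.card hn U D hU rfl (fun S hS => hne S (hD hS)) (fun S hS => hnd S (hD hS)) hDU
      (fun S hS T hT => hdis S (hD hS) T (hD hT)) ?_
    rintro R ⟨f, hf, hfe⟩
    exact hcyc R ⟨f, hf.trans (Finset.val_le_iff.2 hD), hfe⟩
  have key := IsLinkleafOn.glue (W1 : Set V) (W2 : Set V) C1.val C2.val B
    (hrec W1 C1 (Finset.filter_subset _ _) (by omega) (by omega) hin1)
    (hrec W2 C2 (Finset.filter_subset _ _) (by omega) (by omega) hin2)
    (by exact_mod_cast hWd) ⟨e0, he0⟩ (by exact_mod_cast hcross)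
  have hv : C.val = C1.val + B ::ₘ C2.val := by
    have h1 : (C.erase B).val = C1.val + C2.val := by
      rw [← hunion, ← Finset.disjUnion_eq_union _ _ hCd, Finset.disjUnion_val]
    rw [Multiset.add_cons, ← h1, Finset.erase_val, Multiset.cons_erase hB]
  rw [hv, ← hWu, Finset.coe_union]
  exact key

theorem linkleaf_mem {V : Type*} {W : Set V} {E : Multiset (Finset (Sym2 V))}
    (h : IsLinkleafOn W E) : ∀ S ∈ E, ∀ e ∈ S, ∀ v ∈ e, v ∈ W := by
  induction h with
  | single v => simp
  | glue W₁ W₂ E₁ E₂ B h1 h2 hd hB hc ih1 ih2 =>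
    intro S hS e he v hv
    rcases Multiset.mem_add.1 hS with h | h
    · exact Or.inl (ih1 S h e he v hv)
    · rcases Multiset.mem_cons.1 h with rfl | h
      · obtain ⟨a, b, rfl, ha, hb⟩ := hc e he
        rcases Sym2.mem_iff.1 hv with rfl | rfl
        · exact Or.inl ha
        · exact Or.inr hb
      · exact Or.inr (ih2 S h e he v hv)

theorem walk_side {V : Type*} {G : SimpleGraph V} (W : Set V) {a b : V} (w : G.Walk a b)
    (h : ∀ u v, s(u, v) ∈ w.edges → (u ∈ W ↔ v ∈ W)) : a ∈ W ↔ b ∈ W := by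
  induction w with
  | nil => rfl
  | cons hadj p ih =>
    exact (h _ _ (by simp)).trans (ih (fun u v huv => h u v (by simp [huv])))

theorem walk_side_all {V : Type*} {G : SimpleGraph V} (W : Set V) {a b : V} (w : G.Walk a b)
    (h : ∀ u v, s(u, v) ∈ w.edges → (u ∈ W ↔ v ∈ W)) :
    ∀ e ∈ w.edges, ∀ v ∈ e, (v ∈ W ↔ a ∈ W) := by
  induction w with
  | nil => simp
  | cons hadj p ih =>
    intro e he v hv
    have h0 := h _ _ (List.mem_cons_self)
    rw [SimpleGraph.Walk.edges_cons, List.mem_cons] at he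
    rcases he with rfl | he
    · rcases Sym2.mem_iff.1 hv with rfl | rfl
      · rfl
      · exact h0.symm
    · exact (ih (fun u v huv => h u v (by simp [huv])) e he v hv).trans h0.symm

theorem cross_two {V : Type*} {G : SimpleGraph V} (W : Set V) {a : V} (w : G.Walk a a)
    (hw : w.edges.Nodup) (u v : V) (huv : s(u, v) ∈ w.edges) (hu : u ∈ W) (hv : v ∉ W) :
    ∃ c d, s(c, d) ∈ w.edges ∧ s(c, d) ≠ s(u, v) ∧ ¬ (c ∈ W ↔ d ∈ W) := by
  by_contra hcon
  push Not at hcon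
  have hgen : ∀ {x y : V} (p : G.Walk x y), p.edges.Nodup → s(u, v) ∈ p.edges →
      (∀ c d, s(c, d) ∈ p.edges → s(c, d) ≠ s(u, v) → (c ∈ W ↔ d ∈ W)) → ¬ (x ∈ W ↔ y ∈ W) := by
    intro x y p
    induction p with
    | nil => simp
    | @cons x y z hadj p ih =>
      intro hnd hmem hc
      rw [SimpleGraph.Walk.edges_cons, List.nodup_cons] at hnd
      by_cases he : s(x, y) = s(u, v)
      · have h1 := walk_side W p (fun c d hcd => hc c d (by simp [hcd])
          (fun h => hnd.1 (by rw [he, ← h]; exact hcd)))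
        rw [← h1]
        rcases Sym2.eq_iff.1 he with ⟨rfl, rfl⟩ | ⟨rfl, rfl⟩ <;> tauto
      · have hmem' : s(u, v) ∈ p.edges := by
          rw [SimpleGraph.Walk.edges_cons, List.mem_cons] at hmem
          exact hmem.resolve_left (fun h => he h.symm)
        have h1 := ih hnd.2 hmem' (fun c d hcd => hc c d (by simp [hcd]))
        have h2 := hc x y (by simp) he
        tauto
  exact hgen w hw huv hcon Iff.rfl

theorem rainbow_restrict {α : Type*} (E F : Multiset (Finset α)) (R : Finset α) (f : α → Finset α)
    (hf : Multiset.map f R.val ≤ E + F) (hR : ∀ e ∈ R, e ∈ f e)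
    (hF : ∀ e ∈ R, ∀ S ∈ F, e ∉ S) : IsRainbowM E R := by
  classical
  refine ⟨f, ?_, hR⟩
  rw [Multiset.le_iff_count]
  intro S
  by_cases hS : S ∈ Multiset.map f R.val
  · obtain ⟨e, he, rfl⟩ := Multiset.mem_map.1 hS
    have h1 : f e ∉ F := fun h => hF e he _ h (hR e he)
    have := Multiset.le_iff_count.1 hf (f e)
    rwa [Multiset.count_add, Multiset.count_eq_zero_of_notMem h1, add_zero] at this
  · rw [Multiset.count_eq_zero_of_notMem hS]
    exact Nat.zero_le _

theorem no_rainbow_of_linkleaf {V : Type*} [DecidableEq V] {W : Set V}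
    {E : Multiset (Finset (Sym2 V))} (h : IsLinkleafOn W E) :
    ∀ R, IsRainbowM E R → ¬ IsCycleEdgeSet R := by
  induction h with
  | single v =>
    rintro R ⟨f, hf, -⟩ ⟨a, w, hw, rfl⟩
    have h0 : Multiset.map f w.edges.toFinset.val = 0 := le_antisymm hf (Multiset.zero_le _)
    rw [Multiset.map_eq_zero, Finset.val_eq_zero, List.toFinset_eq_empty_iff] at h0
    have := hw.three_le_length
    rw [← SimpleGraph.Walk.length_edges, h0] at this
    simp at this
  | glue W₁ W₂ E₁ E₂ B h1 h2 hd hB hc ih1 ih2 =>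
    rintro R ⟨f, hf, hfe⟩ ⟨a, w, hw, rfl⟩
    have hm1 := linkleaf_mem h1
    have hm2 := linkleaf_mem h2
    have hd' : ∀ v, v ∈ W₁ → v ∉ W₂ := fun v h h' => Set.disjoint_left.1 hd h h'
    have hmem : ∀ e ∈ w.edges, f e ∈ E₁ ∨ f e = B ∨ f e ∈ E₂ := by
      intro e he
      have := Multiset.mem_of_le hf (Multiset.mem_map_of_mem f (List.mem_toFinset.2 he))
      rcases Multiset.mem_add.1 this with h | h
      · exact Or.inl h
      · exact Or.inr (Multiset.mem_cons.1 h)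
    have hcrossB : ∀ u v, s(u, v) ∈ w.edges → ¬ (u ∈ W₁ ↔ v ∈ W₁) → f s(u, v) = B := by
      intro u v huv hn
      have he := hfe _ (List.mem_toFinset.2 huv)
      rcases hmem _ huv with h | h | h
      · exact absurd (iff_of_true (hm1 _ h _ he u (by simp)) (hm1 _ h _ he v (by simp))) hn
      · exact h
      · exact absurd (iff_of_false (fun h' => hd' _ h' (hm2 _ h _ he u (by simp)))
          (fun h' => hd' _ h' (hm2 _ h _ he v (by simp)))) hn
    have hBcross : ∀ u v, s(u, v) ∈ B → ¬ (u ∈ W₁ ↔ v ∈ W₁) := by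
      intro u v huv
      obtain ⟨c, d, hcd, hc1, hd2⟩ := hc _ huv
      have : d ∉ W₁ := fun h => hd' _ h hd2
      rcases Sym2.eq_iff.1 hcd with ⟨rfl, rfl⟩ | ⟨rfl, rfl⟩ <;> tauto
    have hBE1 : B ∉ E₁ := by
      intro h
      obtain ⟨e, he⟩ := hB
      obtain ⟨c, d, rfl, hc1, hd2⟩ := hc _ he
      exact hd' d (hm1 _ h _ he d (by simp)) hd2
    have hBE2 : B ∉ E₂ := by
      intro h
      obtain ⟨e, he⟩ := hB
      obtain ⟨c, d, rfl, hc1, hd2⟩ := hc _ he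
      exact hd' c hc1 (hm2 _ h _ he c (by simp))
    have hone : ∀ e ∈ w.edges, ∀ e' ∈ w.edges, e ≠ e' → f e = B → f e' = B → False := by
      intro e he e' he' hne hfe1 hfe2
      have hcnt := Multiset.le_iff_count.1 hf B
      rw [Multiset.count_add, Multiset.count_cons_self, Multiset.count_eq_zero_of_notMem hBE1,
        Multiset.count_eq_zero_of_notMem hBE2] at hcnt
      have hsub : ({e, e'} : Finset (Sym2 V)).val ≤ w.edges.toFinset.val := by
        rw [Finset.val_le_iff]
        intro z hz
        simp only [Finset.mem_insert, Finset.mem_singleton] at hz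
        rcases hz with rfl | rfl <;> simpa
      have h3 := Multiset.le_iff_count.1 (Multiset.map_le_map (f := f) hsub) B
      rw [Finset.insert_val_of_notMem (by simpa using hne)] at h3
      rw [Finset.singleton_val, Multiset.map_cons, Multiset.map_singleton, hfe1, hfe2,
        Multiset.count_cons_self, Multiset.count_singleton_self] at h3
      omega
    have hno : ∀ u v, s(u, v) ∈ w.edges → (u ∈ W₁ ↔ v ∈ W₁) := by
      intro u v huv
      by_contra hn
      have hex : ∃ c d, s(c, d) ∈ w.edges ∧ s(c, d) ≠ s(u, v) ∧ ¬ (c ∈ W₁ ↔ d ∈ W₁) := by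
        by_cases hu : u ∈ W₁
        · exact cross_two W₁ w hw.edges_nodup u v huv hu (by tauto)
        · rw [Sym2.eq_swap] at huv ⊢
          exact cross_two W₁ w hw.edges_nodup v u huv (by tauto) hu
      obtain ⟨c, d, hcd, hne, hn'⟩ := hex
      exact hone _ hcd _ huv hne (hcrossB _ _ hcd hn') (hcrossB _ _ huv hn)
    have hall := walk_side_all W₁ w hno
    have hBno : ∀ e ∈ w.edges, e ∉ B := by
      intro e he heB
      induction e with | _ u v =>
      exact hBcross u v heB (hno u v he)
    by_cases ha : a ∈ W₁
    · refine ih1 _ (rainbow_restrict E₁ (B ::ₘ E₂) _ f hf hfe ?_) ⟨a, w, hw, rfl⟩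
      intro e he S hS heS
      rw [List.mem_toFinset] at he
      rcases Multiset.mem_cons.1 hS with rfl | hS
      · exact hBno e he heS
      · induction e with | _ u v =>
        exact hd' u ((hall _ he u (by simp)).2 ha) (hm2 _ hS _ heS u (by simp))
    · refine ih2 _ (rainbow_restrict E₂ (B ::ₘ E₁) _ f ?_ hfe ?_) ⟨a, w, hw, rfl⟩
      · rwa [Multiset.add_cons, add_comm, ← Multiset.add_cons, Multiset.add_cons,
          ← Multiset.add_cons] at hf
      intro e he S hS heS
      rw [List.mem_toFinset] at he
      rcases Multiset.mem_cons.1 hS with rfl | hS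
      · exact hBno e he heS
      · induction e with | _ u v =>
        exact ha ((hall _ he u (by simp)).1 (hm1 _ hS _ heS u (by simp)))

/-- A family of `n` pairwise edge-disjoint nonempty subgraphs of `K_{n+1}` has no
rainbow cycle iff it is a linkleaf. -/
theorem no_rainbow_cycle_iff_linkleaf (n : ℕ)
    (E : Multiset (Finset (Sym2 (Fin (n + 1)))))
    (hcard : Multiset.card E = n)
    (hvalid : ∀ S ∈ E, S.Nonempty ∧ ∀ e ∈ S, ¬ e.IsDiag)
    (hdisj : E.Pairwise (fun S T => Disjoint S T)) :
    (¬ ∃ R : Finset (Sym2 (Fin (n + 1))), IsRainbowM E R ∧ IsCycleEdgeSet R) ↔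
      ∃ W : Set (Fin (n + 1)), IsLinkleafOn W E := by
  constructor
  · intro hno
    obtain ⟨L, rfl, hL⟩ := hdisj
    have hnd : (L : Multiset (Finset (Sym2 (Fin (n + 1))))).Nodup := by
      rw [Multiset.coe_nodup]
      refine List.Pairwise.imp_of_mem ?_ hL
      rintro S T hS hT hST rfl
      obtain ⟨e, he⟩ := (hvalid S (by simpa using hS)).1
      exact Finset.disjoint_left.1 hST he he
    refine ⟨_, linkleaf_of_no_rainbow n Finset.univ ⟨_, hnd⟩ (by simp) hcard
      (fun S hS => (hvalid S hS).1) (fun S hS => (hvalid S hS).2) (by simp) ?_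
      (fun R h1 h2 => hno ⟨R, h1, h2⟩)⟩
    intro S hS T hT hne
    have : Std.Symm (fun S T : Finset (Sym2 (Fin (n + 1))) => Disjoint S T) :=
      ⟨fun _ _ h => h.symm⟩
    exact hL.forall (by simpa using hS) (by simpa using hT) hne
  · rintro ⟨W, hW⟩ ⟨R, h1, h2⟩
    exact no_rainbow_of_linkleaf hW R h1 h2
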